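/- Let π be a Generalized Lakshmibai–Seshadri path of shape λ ∈ P^+ and let i ∈ I^{im}. Then the function h_i^π is increasing on [0,1], m_i^π = 0, and exactly one of the following holds: (1) f_+^i(π) = 0, f_iπ ≠ 0, and h_i^π is strictly increasing in a neighbourhood of 0; (2) f_+^i(π) = 1, f_iπ = 0, and h_i^π is identically 0. Moreover, e_iπ = 0 (as a path operator on the set of all paths) if and only if α_i^∨(π(1)) < 1 − a_{ii}. -/

import Mathlib

namespace GKM

variable {I V : Type*} [AddCommGroup V] [Module ℚ V]

/-- The simple "reflection" `r_i : x ↦ x - α_i^∨(x) • α_i` (an endomorphism of `h*`). -/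
def srefl (α : I → V) (coroot : I → (V →ₗ[ℚ] ℚ)) (i : I) : Module.End ℚ V :=
  LinearMap.id - (coroot i).smulRight (α i)

/-- The dual map `h ↦ h - h(α_i) • α_i^∨` on linear functionals; for a real index `i`
this is `r_i^∨ : h ↦ h ∘ r_i⁻¹ = h ∘ r_i`. -/
def crefl (α : I → V) (coroot : I → (V →ₗ[ℚ] ℚ)) (i : I) :
    Module.End ℚ (V →ₗ[ℚ] ℚ) :=
  LinearMap.id - (LinearMap.applyₗ (α i)).smulRight (coroot i)

/-- The monoid `T` generated by all the `r_i`, `i ∈ I`. -/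
def Tmon (α : I → V) (coroot : I → (V →ₗ[ℚ] ℚ)) : Submonoid (Module.End ℚ V) :=
  Submonoid.closure (Set.range (srefl α coroot))

/-- The Weyl group `W` generated by the `r_i` with `i` real; since each generator is an
involution, the submonoid it generates coincides with the group it generates. -/
def Wmon (A : I → I → ℤ) (α : I → V) (coroot : I → (V →ₗ[ℚ] ℚ)) :
    Submonoid (Module.End ℚ V) :=
  Submonoid.closure (srefl α coroot '' {i | A i i = 2})

/-- `Q^+`, the set of `ℕ`-linear combinations of simple roots. -/
def Qplus (α : I → V) : Set V :=
  {x | ∃ c : I →₀ ℕ, x = c.sum fun i n => (n : ℚ) • α i}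

/-- The weight lattice `P`. -/
def Pint (coroot : I → (V →ₗ[ℚ] ℚ)) : Set V :=
  {x | ∀ i, ∃ n : ℤ, coroot i x = (n : ℚ)}

/-- The dominant integral weights `P^+`. -/
def Pplus (coroot : I → (V →ₗ[ℚ] ℚ)) : Set V :=
  {x | (∀ i, ∃ n : ℤ, coroot i x = (n : ℚ)) ∧ ∀ i, 0 ≤ coroot i x}

/-- The orbit `Tλ`. -/
def Torbit (α : I → V) (coroot : I → (V →ₗ[ℚ] ℚ)) (lam : V) : Set V :=
  {x | ∃ τ, τ ∈ Tmon α coroot ∧ τ lam = x}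

/-- The reduced length of `τ ∈ T` with respect to all generators `r_i`, `i ∈ I`. -/
noncomputable def lenT (α : I → V) (coroot : I → (V →ₗ[ℚ] ℚ))
    (τ : Module.End ℚ V) : ℕ :=
  sInf {n | ∃ l : List I, l.length = n ∧ (l.map (srefl α coroot)).prod = τ}

/-- The reduced length of `w ∈ W` with respect to the real generators. -/
noncomputable def lenW (A : I → I → ℤ) (α : I → V) (coroot : I → (V →ₗ[ℚ] ℚ))
    (w : Module.End ℚ V) : ℕ :=
  sInf {n | ∃ l : List I, (∀ m ∈ l, A m m = 2) ∧ l.length = n ∧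
    (l.map (srefl α coroot)).prod = w}

/-- The reflection `r_β : x ↦ x - β^∨(x) • β` attached to a root/coroot pair. -/
def reflRoot (β : V) (βv : V →ₗ[ℚ] ℚ) : Module.End ℚ V :=
  LinearMap.id - βv.smulRight β

/-- A presentation of `β = w α_k ∈ WΠ` together with its coroot `β^∨ = w^∨ α_k^∨`,
via a word `l` (with real entries) for `w`. -/
def IsWRootPres (A : I → I → ℤ) (α : I → V) (coroot : I → (V →ₗ[ℚ] ℚ))
    (l : List I) (k : I) (β : V) (βv : V →ₗ[ℚ] ℚ) : Prop :=
  (∀ m ∈ l, A m m = 2) ∧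
  β = (l.map (srefl α coroot)).prod (α k) ∧
  βv = (l.map (crefl α coroot)).prod (coroot k)

/-- `β ∈ WΠ` with coroot `β^∨`. -/
def IsWRootPair (A : I → I → ℤ) (α : I → V) (coroot : I → (V →ₗ[ℚ] ℚ))
    (β : V) (βv : V →ₗ[ℚ] ℚ) : Prop :=
  ∃ l k, IsWRootPres A α coroot l k β βv

/-- A chain `ν =: c s ← ⋯ ← c 0 := μ` of length `s` inside `Tλ`:
`c k = r_{β k} (c (k+1))` with `β k ∈ WΠ ∩ Q^+` and `(β k)^∨(c (k+1)) > 0`. -/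
def IsChain (A : I → I → ℤ) (α : I → V) (coroot : I → (V →ₗ[ℚ] ℚ))
    (lam μ ν : V) (s : ℕ) (c : ℕ → V) (β : ℕ → V)
    (βv : ℕ → (V →ₗ[ℚ] ℚ)) : Prop :=
  c 0 = μ ∧ c s = ν ∧ (∀ k ≤ s, c k ∈ Torbit α coroot lam) ∧
  ∀ k < s, IsWRootPair A α coroot (β k) (βv k) ∧ β k ∈ Qplus α ∧
    0 < βv k (c (k+1)) ∧ c k = c (k+1) - βv k (c (k+1)) • β k

/-- `μ > ν` in `Tλ`. -/
def ChainGT (A : I → I → ℤ) (α : I → V) (coroot : I → (V →ₗ[ℚ] ℚ))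
    (lam μ ν : V) : Prop :=
  ∃ s, 1 ≤ s ∧ ∃ c β βv, IsChain A α coroot lam μ ν s c β βv

/-- `dist(μ, ν) = n`: there is a chain of length `n` from `μ` to `ν` and every chain
has length at most `n`. -/
def distEq (A : I → I → ℤ) (α : I → V) (coroot : I → (V →ₗ[ℚ] ℚ))
    (lam μ ν : V) (n : ℕ) : Prop :=
  (∃ c β βv, IsChain A α coroot lam μ ν n c β βv) ∧
  ∀ m c β βv, IsChain A α coroot lam μ ν m c β βv → m ≤ n

/-- An `a`-chain for `(μ, ν)`: a chain in which each step is a covering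
(`dist = 1`), `a·β_k^∨(ν_k)` is a positive integer for steps along `WΠ_re`,
and `a·β_k^∨(ν_k) = 1` for steps along `WΠ_im`.  The index `ks k` records the simple
root of which `β k` is a `W`-translate. -/
def IsAChain (A : I → I → ℤ) (α : I → V) (coroot : I → (V →ₗ[ℚ] ℚ))
    (lam : V) (a : ℚ) (μ ν : V) (s : ℕ) (c : ℕ → V)
    (β : ℕ → V) (βv : ℕ → (V →ₗ[ℚ] ℚ)) (ks : ℕ → I) : Prop :=
  1 ≤ s ∧ IsChain A α coroot lam μ ν s c β βv ∧
  ∀ k < s,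
    (∃ l, IsWRootPres A α coroot l (ks k) (β k) (βv k)) ∧
    distEq A α coroot lam (c k) (c (k+1)) 1 ∧
    (A (ks k) (ks k) = 2 → ∃ n : ℕ, 0 < n ∧ a * βv k (c (k+1)) = (n : ℚ)) ∧
    (A (ks k) (ks k) ≠ 2 → a * βv k (c (k+1)) = 1)

/-- Existence of an `a`-chain for `(μ, ν)`. -/
def HasAChain (A : I → I → ℤ) (α : I → V) (coroot : I → (V →ₗ[ℚ] ℚ))
    (lam : V) (a : ℚ) (μ ν : V) : Prop :=
  ∃ s c β βv ks, IsAChain A α coroot lam a μ ν s c β βv ks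

/-- The piecewise-linear path attached to GLS data `(λ_1, …, λ_s ; a_0, …, a_s)`
(weights indexed `1, …, s`, breakpoints indexed `0, …, s`):
on `[a_{j-1}, a_j]` it equals `Σ_{k<j} (a_k - a_{k-1}) • λ_k + (t - a_{j-1}) • λ_j`. -/
def glsPath (lamseq : ℕ → V) (a : ℕ → ℚ) (s : ℕ) (t : ℚ) : V :=
  ∑ k ∈ Finset.range s, (max (min t (a (k+1)) - a k) 0) • lamseq (k+1)

/-- The data of a Generalized Lakshmibai–Seshadri path of shape `lam`. -/
def IsGLS (A : I → I → ℤ) (α : I → V) (coroot : I → (V →ₗ[ℚ] ℚ))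
    (lam : V) (s : ℕ) (lamseq : ℕ → V) (a : ℕ → ℚ) : Prop :=
  1 ≤ s ∧ a 0 = 0 ∧ a s = 1 ∧ (∀ k < s, a k < a (k+1)) ∧
  (∀ k, 1 ≤ k → k ≤ s → lamseq k ∈ Torbit α coroot lam) ∧
  (∀ k, 1 ≤ k → k < s →
    HasAChain A α coroot lam (a k) (lamseq k) (lamseq (k+1))) ∧
  (lamseq s = lam ∨ HasAChain A α coroot lam 1 (lamseq s) lam)

/-- The set `ℙ_λ` of Generalized Lakshmibai–Seshadri paths of shape `lam`,
realized as functions `ℚ → V` via `glsPath`. -/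
def GLSset (A : I → I → ℤ) (α : I → V) (coroot : I → (V →ₗ[ℚ] ℚ))
    (lam : V) : Set (ℚ → V) :=
  {π | ∃ s lamseq a, IsGLS A α coroot lam s lamseq a ∧ π = glsPath lamseq a s}

/-- `h_i^π(t) = α_i^∨(π(t))`. -/
def hFun (coroot : I → (V →ₗ[ℚ] ℚ)) (i : I) (π : ℚ → V) (t : ℚ) : ℚ :=
  coroot i (π t)

/-- `m_i^π`, the minimal integer value attained by `h_i^π` on `[0,1]`. -/
noncomputable def mOf (coroot : I → (V →ₗ[ℚ] ℚ)) (i : I) (π : ℚ → V) : ℤ :=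
  sInf {n : ℤ | ∃ t, 0 ≤ t ∧ t ≤ 1 ∧ hFun coroot i π t = (n : ℚ)}

/-- Two paths agree on `[0,1]`. -/
def pathEq (π π' : ℚ → V) : Prop := ∀ t, 0 ≤ t → t ≤ 1 → π t = π' t

/-- `tp = f_+^i(π)`: the largest point of `[0,1]` where `h_i^π` equals `m_i^π`. -/
def IsFPlus (coroot : I → (V →ₗ[ℚ] ℚ)) (i : I) (π : ℚ → V) (tp : ℚ) : Prop :=
  0 ≤ tp ∧ tp ≤ 1 ∧ hFun coroot i π tp = (mOf coroot i π : ℚ) ∧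
  ∀ t, 0 ≤ t → t ≤ 1 → hFun coroot i π t = (mOf coroot i π : ℚ) → t ≤ tp

/-- `tm = f_-^i(π)`: the smallest point of `[tp,1]` where `h_i^π` equals `m_i^π + 1`. -/
def IsFMinus (coroot : I → (V →ₗ[ℚ] ℚ)) (i : I) (π : ℚ → V) (tp tm : ℚ) : Prop :=
  tp ≤ tm ∧ tm ≤ 1 ∧ hFun coroot i π tm = (mOf coroot i π : ℚ) + 1 ∧
  ∀ t, tp ≤ t → t ≤ 1 → hFun coroot i π t = (mOf coroot i π : ℚ) + 1 → tm ≤ t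

/-- The path `f_i π` (for cutting data `tp = f_+^i(π)`, `tm = f_-^i(π)`). -/
def fPath (α : I → V) (coroot : I → (V →ₗ[ℚ] ℚ)) (i : I) (tp tm : ℚ)
    (π : ℚ → V) (t : ℚ) : V :=
  if t ≤ tp then π t
  else if t ≤ tm then π tp + srefl α coroot i (π t - π tp)
  else π t - α i

/-- `π' = f_i π ≠ 0` (equality of paths on `[0,1]`). -/
def FRel (α : I → V) (coroot : I → (V →ₗ[ℚ] ℚ)) (i : I) (π π' : ℚ → V) : Prop :=
  ∃ tp tm, IsFPlus coroot i π tp ∧ tp < 1 ∧ IsFMinus coroot i π tp tm ∧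
    pathEq π' (fPath α coroot i tp tm π)

/-- `tp = e_+^i(π)` (`i` real): smallest point of `[0,1]` where `h_i^π = m_i^π`. -/
def IsEPlusRe (coroot : I → (V →ₗ[ℚ] ℚ)) (i : I) (π : ℚ → V) (tp : ℚ) : Prop :=
  0 ≤ tp ∧ tp ≤ 1 ∧ hFun coroot i π tp = (mOf coroot i π : ℚ) ∧
  ∀ t, 0 ≤ t → t ≤ 1 → hFun coroot i π t = (mOf coroot i π : ℚ) → tp ≤ t

/-- `tm = e_-^i(π)` (`i` real): largest point of `[0,tp]` where `h_i^π = m_i^π + 1`. -/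
def IsEMinusRe (coroot : I → (V →ₗ[ℚ] ℚ)) (i : I) (π : ℚ → V) (tp tm : ℚ) : Prop :=
  0 ≤ tm ∧ tm ≤ tp ∧ hFun coroot i π tm = (mOf coroot i π : ℚ) + 1 ∧
  ∀ t, 0 ≤ t → t ≤ tp → hFun coroot i π t = (mOf coroot i π : ℚ) + 1 → t ≤ tm

/-- The path `e_i π` for `i` real. -/
def ePathRe (α : I → V) (coroot : I → (V →ₗ[ℚ] ℚ)) (i : I) (tm tp : ℚ)
    (π : ℚ → V) (t : ℚ) : V :=
  if t ≤ tm then π t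
  else if t ≤ tp then π tm + srefl α coroot i (π t - π tm)
  else π t + α i

/-- `π' = e_i π ≠ 0` for a real index `i`. -/
def ERelRe (α : I → V) (coroot : I → (V →ₗ[ℚ] ℚ)) (i : I) (π π' : ℚ → V) : Prop :=
  ∃ tp tm, IsEPlusRe coroot i π tp ∧ 0 < tp ∧ IsEMinusRe coroot i π tp tm ∧
    pathEq π' (ePathRe α coroot i tm tp π)

/-- The "inverse reflection" `r_i^{-1} : x ↦ x + (1/(1-a_{ii})) α_i^∨(x) α_i`
for an imaginary index `i`. -/
def rinv (A : I → I → ℤ) (α : I → V) (coroot : I → (V →ₗ[ℚ] ℚ)) (i : I) :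
    Module.End ℚ V :=
  LinearMap.id + (1 / (1 - (A i i : ℚ))) • (coroot i).smulRight (α i)

/-- `tp = e_+^i(π)` (`i` imaginary): smallest point of `[tm,1]` where
`h_i^π = m_i^π + 1 - a_{ii}` (here `tm = e_-^i(π) = f_+^i(π)`). -/
def IsEPlusIm (A : I → I → ℤ) (coroot : I → (V →ₗ[ℚ] ℚ)) (i : I) (π : ℚ → V)
    (tm tp : ℚ) : Prop :=
  tm ≤ tp ∧ tp ≤ 1 ∧
  hFun coroot i π tp = (mOf coroot i π : ℚ) + 1 - (A i i : ℚ) ∧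
  ∀ t, tm ≤ t → t ≤ 1 →
    hFun coroot i π t = (mOf coroot i π : ℚ) + 1 - (A i i : ℚ) → tp ≤ t

/-- The path `e_i π` for `i` imaginary. -/
def ePathIm (A : I → I → ℤ) (α : I → V) (coroot : I → (V →ₗ[ℚ] ℚ)) (i : I)
    (tm tp : ℚ) (π : ℚ → V) (t : ℚ) : V :=
  if t ≤ tm then π t
  else if t ≤ tp then π tm + rinv A α coroot i (π t - π tm)
  else π t + α i

/-- `π' = e_i π ≠ 0` for an imaginary index `i`:  `e_-^i(π) = f_+^i(π) < 1`, the point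
`e_+^i(π)` exists, and `h_i^π` never drops to `m_i^π - a_{ii}` on `[e_+^i(π), 1]`. -/
def ERelIm (A : I → I → ℤ) (α : I → V) (coroot : I → (V →ₗ[ℚ] ℚ)) (i : I)
    (π π' : ℚ → V) : Prop :=
  ∃ tm tp, IsFPlus coroot i π tm ∧ tm < 1 ∧ IsEPlusIm A coroot i π tm tp ∧
    (∀ t, tp ≤ t → t ≤ 1 →
      (mOf coroot i π : ℚ) - (A i i : ℚ) < hFun coroot i π t) ∧
    pathEq π' (ePathIm A α coroot i tm tp π)

/-- `π' = e_i π ≠ 0`. -/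
def ERel (A : I → I → ℤ) (α : I → V) (coroot : I → (V →ₗ[ℚ] ℚ)) (i : I)
    (π π' : ℚ → V) : Prop :=
  (A i i = 2 ∧ ERelRe α coroot i π π') ∨ (A i i ≠ 2 ∧ ERelIm A α coroot i π π')

/-- `π' = f_{i_1} ⋯ f_{i_k} π ≠ 0` for a list `[i_1, …, i_k]` (rightmost acts first). -/
def FMonRel (α : I → V) (coroot : I → (V →ₗ[ℚ] ℚ)) :
    List I → (ℚ → V) → (ℚ → V) → Prop
  | [], π, π' => pathEq π π'
  | i :: l, π, π' => ∃ πm, FMonRel α coroot l π πm ∧ FRel α coroot i πm π'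

/-- A generalized crystal for the Borcherds–Cartan datum `(A, α, coroot)`. -/
structure GenCrystal (A : I → I → ℤ) (α : I → V)
    (coroot : I → (V →ₗ[ℚ] ℚ)) where
  B : Type*
  wt : B → V
  wt_int : ∀ (i : I) (b : B), ∃ n : ℤ, coroot i (wt b) = (n : ℚ)
  eps : I → B → WithBot ℤ
  phi : I → B → WithBot ℤ
  e : I → B → Option B
  f : I → B → Option B
  phi_eq : ∀ (i : I) (b : B) (n : ℤ), (n : ℚ) = coroot i (wt b) →
    phi i b = eps i b + (n : WithBot ℤ)
  wt_e : ∀ (i : I) (b b' : B), e i b = some b' → wt b' = wt b + α i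
  eps_e_re : ∀ (i : I) (b b' : B), A i i = 2 → e i b = some b' →
    eps i b' = eps i b + ((-1 : ℤ) : WithBot ℤ)
  eps_e_im : ∀ (i : I) (b b' : B), A i i ≠ 2 → e i b = some b' →
    eps i b' = eps i b
  e_iff_f : ∀ (i : I) (b b' : B), e i b = some b' ↔ f i b' = some b
  phi_bot : ∀ (i : I) (b : B), phi i b = ⊥ → e i b = none ∧ f i b = none
  eps_im : ∀ (i : I) (b : B), A i i ≠ 2 → eps i b ≤ 0
  phi_im : ∀ (i : I) (b : B), A i i ≠ 2 → phi i b = ⊥ ∨ 0 ≤ phi i b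

/-- Finite "orthogonal" subsets of the imaginary simple roots, encoded by their
index sets: `F ∈ 𝒫(Π_im)`. -/
def PImSet (A : I → I → ℤ) (F : Finset I) : Prop :=
  (∀ i ∈ F, A i i ≠ 2) ∧ ∀ i ∈ F, ∀ j ∈ F, i ≠ j → A i j = 0

end GKM

namespace GKM

section WeylGroup

variable {I V : Type*} [AddCommGroup V] [Module ℚ V]
  {A : I → I → ℤ} {α : I → V} {coroot : I → (V →ₗ[ℚ] ℚ)}

theorem srefl_apply (i : I) (x : V) :
    srefl α coroot i x = x - coroot i x • α i := by
  simp [srefl]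

theorem srefl_mul_self (hpair : ∀ i j, coroot i (α j) = (A i j : ℚ)) {i : I}
    (hi : A i i = 2) : srefl α coroot i * srefl α coroot i = 1 := by
  ext x
  simp only [Module.End.mul_apply, srefl_apply, map_sub, map_smul, hpair, hi,
    Module.End.one_apply]
  push_cast
  module

theorem mul_srefl_mul_srefl (hpair : ∀ i j, coroot i (α j) = (A i j : ℚ)) {i : I}
    (hi : A i i = 2) (w : Module.End ℚ V) :
    w * srefl α coroot i * srefl α coroot i = w := by
  rw [mul_assoc, srefl_mul_self hpair hi, mul_one]

theorem srefl_mem_Wmon {i : I} (hi : A i i = 2) : srefl α coroot i ∈ Wmon A α coroot :=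
  Submonoid.subset_closure ⟨i, hi, rfl⟩

theorem prod_mem_Wmon {l : List I} (hl : ∀ m ∈ l, A m m = 2) :
    (l.map (srefl α coroot)).prod ∈ Wmon A α coroot := by
  refine Submonoid.list_prod_mem _ fun x hx => ?_
  obtain ⟨m, hm, rfl⟩ := List.mem_map.1 hx
  exact srefl_mem_Wmon (hl m hm)

/-- Every element of `W` has a reduced word. -/
theorem exists_reduced_word {w : Module.End ℚ V} (hw : w ∈ Wmon A α coroot) :
    ∃ l : List I, (∀ m ∈ l, A m m = 2) ∧ l.length = lenW A α coroot w ∧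
      (l.map (srefl α coroot)).prod = w := by
  refine Nat.sInf_mem (s := {n | ∃ l : List I, (∀ m ∈ l, A m m = 2) ∧ l.length = n ∧
    (l.map (srefl α coroot)).prod = w}) ?_
  induction hw using Submonoid.closure_induction with
  | mem x hx =>
    obtain ⟨i, hi, rfl⟩ := hx
    exact ⟨1, [i], by simpa using hi, rfl, by simp⟩
  | one => exact ⟨0, [], by simp, rfl, by simp⟩
  | mul x y _ _ hx hy =>
    obtain ⟨_, l, hl, -, rfl⟩ := hx
    obtain ⟨_, l', hl', -, rfl⟩ := hy
    refine ⟨_, l ++ l', fun m hm => ?_, rfl, by simp⟩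
    exact (List.mem_append.1 hm).elim (hl m) (hl' m)

theorem lenW_prod_le {l : List I} (hl : ∀ m ∈ l, A m m = 2) :
    lenW A α coroot (l.map (srefl α coroot)).prod ≤ l.length :=
  Nat.sInf_le ⟨l, hl, rfl, rfl⟩

theorem lenW_mul_le {u v : Module.End ℚ V} (hu : u ∈ Wmon A α coroot)
    (hv : v ∈ Wmon A α coroot) :
    lenW A α coroot (u * v) ≤ lenW A α coroot u + lenW A α coroot v := by
  obtain ⟨l, hl, hlen, rfl⟩ := exists_reduced_word hu
  obtain ⟨l', hl', hlen', rfl⟩ := exists_reduced_word hv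
  rw [← hlen, ← hlen', ← List.length_append, ← List.prod_append, ← List.map_append]
  exact lenW_prod_le fun m hm => (List.mem_append.1 hm).elim (hl m) (hl' m)

theorem lenW_one : lenW A α coroot 1 = 0 := by
  simpa using lenW_prod_le (A := A) (α := α) (coroot := coroot) (l := []) (by simp)

theorem lenW_srefl_le {i : I} (hi : A i i = 2) :
    lenW A α coroot (srefl α coroot i) ≤ 1 := by
  simpa using lenW_prod_le (A := A) (α := α) (coroot := coroot) (l := [i]) (by simpa using hi)

theorem lenW_mul_srefl_le {w : Module.End ℚ V} (hw : w ∈ Wmon A α coroot) {i : I}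
    (hi : A i i = 2) :
    lenW A α coroot (w * srefl α coroot i) ≤ lenW A α coroot w + 1 :=
  (lenW_mul_le hw (srefl_mem_Wmon hi)).trans (Nat.add_le_add_left (lenW_srefl_le hi) _)

/-- A nontrivial element of `W` has a right descent. -/
theorem exists_right_descent (hpair : ∀ i j, coroot i (α j) = (A i j : ℚ))
    {w : Module.End ℚ V} (hw : w ∈ Wmon A α coroot) (hw1 : w ≠ 1) :
    ∃ t, A t t = 2 ∧ lenW A α coroot (w * srefl α coroot t) < lenW A α coroot w := by
  obtain ⟨l, hl, hlen, rfl⟩ := exists_reduced_word hw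
  rcases List.eq_nil_or_concat' l with rfl | ⟨l, t, rfl⟩
  · simp at hw1
  · have ht : A t t = 2 := hl t (by simp)
    refine ⟨t, ht, ?_⟩
    rw [← hlen]
    simp only [List.map_append, List.map_cons, List.map_nil, List.prod_append, List.prod_singleton,
      mul_srefl_mul_srefl hpair ht, List.length_append, List.length_singleton, Nat.lt_succ_iff]
    exact lenW_prod_le fun m hm => hl m (by simp [hm])

/-- The alternating product `⋯ r_s r_t` with `k` factors, ending in `r_t`. -/
def altProd (α : I → V) (coroot : I → (V →ₗ[ℚ] ℚ)) : ℕ → I → I → Module.End ℚ V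
  | 0, _, _ => 1
  | k + 1, s, t => altProd α coroot k t s * srefl α coroot t

theorem altProd_mem_and_lenW_le (k : ℕ) {s t : I} (hs : A s s = 2) (ht : A t t = 2) :
    altProd α coroot k s t ∈ Wmon A α coroot ∧
      lenW A α coroot (altProd α coroot k s t) ≤ k := by
  induction k generalizing s t with
  | zero => exact ⟨one_mem _, lenW_one.le⟩
  | succ k ih =>
    obtain ⟨hmem, hlen⟩ := ih ht hs
    exact ⟨mul_mem hmem (srefl_mem_Wmon ht),
      (lenW_mul_srefl_le hmem ht).trans (Nat.add_le_add_right hlen 1)⟩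

theorem altProd_add (j m : ℕ) {s t : I} (hs : A s s = 2) (ht : A t t = 2) :
    ∃ x ∈ Wmon A α coroot, lenW A α coroot x ≤ j ∧
      altProd α coroot (j + m) s t = x * altProd α coroot m s t := by
  induction m generalizing s t with
  | zero =>
    obtain ⟨hmem, hlen⟩ := altProd_mem_and_lenW_le (α := α) (coroot := coroot) j hs ht
    exact ⟨_, hmem, hlen, by simp [altProd]⟩
  | succ m ih =>
    obtain ⟨x, hx, hlen, h⟩ := ih ht hs
    exact ⟨x, hx, hlen, by rw [← add_assoc, altProd, altProd, h, mul_assoc]⟩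

/-- Stripping right descents alternately from `w`. -/
theorem exists_eq_mul_altProd (hpair : ∀ i j, coroot i (α j) = (A i j : ℚ))
    {s t : I} (hs : A s s = 2) (ht : A t t = 2) {w : Module.End ℚ V}
    (hw : w ∈ Wmon A α coroot)
    (hws : lenW A α coroot w ≤ lenW A α coroot (w * srefl α coroot s)) :
    ∃ v ∈ Wmon A α coroot, ∃ k, w = v * altProd α coroot k s t ∧
      lenW A α coroot v + k = lenW A α coroot w ∧
      lenW A α coroot v ≤ lenW A α coroot (v * srefl α coroot s) ∧
      lenW A α coroot v ≤ lenW A α coroot (v * srefl α coroot t) := by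
  induction hn : lenW A α coroot w using Nat.strong_induction_on generalizing w s t with
  | _ n ih =>
    subst hn
    by_cases hwt : lenW A α coroot w ≤ lenW A α coroot (w * srefl α coroot t)
    · exact ⟨w, hw, 0, by simp [altProd], rfl, hws, hwt⟩
    · push Not at hwt
      have hmem := mul_mem hw (srefl_mem_Wmon (α := α) (coroot := coroot) ht)
      have hback := mul_srefl_mul_srefl hpair ht w
      have hle := lenW_mul_srefl_le hmem ht
      rw [hback] at hle
      obtain ⟨v, hv, k, hvk, hlen, h1, h2⟩ :=
        ih _ hwt ht hs hmem (by rw [hback]; exact hwt.le) rfl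
      refine ⟨v, hv, k + 1, ?_, by omega, h2, h1⟩
      rw [altProd, ← mul_assoc, ← hvk, hback]

theorem altProd_succ_comb (hpair : ∀ i j, coroot i (α j) = (A i j : ℚ)) {s t : I}
    (ht : A t t = 2) (k : ℕ) (a b : ℚ) :
    altProd α coroot (k + 1) s t (a • α s + b • α t) =
      altProd α coroot k t s ((-A t s * a - b) • α t + a • α s) := by
  rw [altProd, Module.End.mul_apply]
  congr 1
  simp only [srefl_apply, map_add, map_smul, hpair, ht]
  push_cast
  module

theorem altProd_succ_sub (hpair : ∀ i j, coroot i (α j) = (A i j : ℚ)) {s t : I}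
    (ht : A t t = 2) (k : ℕ) (a b : ℚ) (x : V) :
    altProd α coroot (k + 1) s t (x - (a • α s + b • α t)) =
      altProd α coroot k t s (x - ((coroot t x - b - A t s * a) • α t + a • α s)) := by
  rw [altProd, Module.End.mul_apply]
  congr 1
  simp only [srefl_apply, map_sub, map_add, map_smul, hpair, ht]
  push_cast
  module

/-- `z` is a nonnegative combination of `x` and `y`. -/
def IsPosComb (x y z : V) : Prop :=
  ∃ a b : ℚ, 0 ≤ a ∧ 0 ≤ b ∧ z = a • x + b • y

theorem IsPosComb.swap {x y z : V} (h : IsPosComb x y z) : IsPosComb y x z := by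
  obtain ⟨a, b, ha, hb, rfl⟩ := h
  exact ⟨b, a, hb, ha, add_comm _ _⟩

theorem isPosComb_altProd_zero {s t : I} {a b : ℚ} (ha : 0 ≤ a) (hb : 0 ≤ b) :
    IsPosComb (α s) (α t) (altProd α coroot 0 s t (a • α s + b • α t)) :=
  ⟨a, b, ha, hb, by simp [altProd]⟩

theorem isPosComb_altProd_succ (hpair : ∀ i j, coroot i (α j) = (A i j : ℚ)) {s t : I}
    (ht : A t t = 2) {k : ℕ} {a b : ℚ}
    (h : IsPosComb (α t) (α s)
      (altProd α coroot k t s ((-A t s * a - b) • α t + a • α s))) :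
    IsPosComb (α s) (α t) (altProd α coroot (k + 1) s t (a • α s + b • α t)) := by
  rw [altProd_succ_comb hpair ht]
  exact h.swap

/-- In the infinite dihedral case all alternating products keep the root positive. -/
theorem isPosComb_altProd_of_four_le (hpair : ∀ i j, coroot i (α j) = (A i j : ℚ))
    {s t : I} (hs : A s s = 2) (ht : A t t = 2) (hst : A s t ≤ 0) (hts : A t s ≤ 0)
    (h4 : 4 ≤ A s t * A t s) (k : ℕ) {a b : ℚ} (ha : 0 ≤ a) (hb : 0 ≤ b)
    (hab : -A s t * b ≤ 2 * a) :
    IsPosComb (α s) (α t) (altProd α coroot k s t (a • α s + b • α t)) := by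
  induction k generalizing s t a b with
  | zero => exact isPosComb_altProd_zero ha hb
  | succ k ih =>
    have hst' : (A s t : ℚ) ≤ 0 := by exact_mod_cast hst
    have hts' : (A t s : ℚ) ≤ 0 := by exact_mod_cast hts
    have h4' : (4 : ℚ) ≤ A s t * A t s := by exact_mod_cast h4
    have key : 2 * b ≤ -A t s * a := by
      have h1 := mul_le_mul_of_nonneg_left hab (neg_nonneg.2 hts')
      have h2 := mul_le_mul_of_nonneg_right h4' hb
      nlinarith
    refine isPosComb_altProd_succ hpair ht
      (ih ht hs hts hst (by rwa [mul_comm]) ?_ ha ?_) <;> linarith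

/-- Rank two dichotomy: either all alternating products ending in `r_t` keep `α_s` positive, or
there is a braid relation of length `m` and this holds for those with fewer than `m` factors. -/
theorem rank_two (hpair : ∀ i j, coroot i (α j) = (A i j : ℚ))
    {s t : I} (hs : A s s = 2) (ht : A t t = 2) (hst : A s t ≤ 0) (hts : A t s ≤ 0)
    (hz : A s t = 0 ↔ A t s = 0) :
    (∀ k, IsPosComb (α s) (α t) (altProd α coroot k s t (α s))) ∨
    ∃ m, altProd α coroot (m + 1) s t = altProd α coroot (m + 1) t s ∧
      ∀ k ≤ m, IsPosComb (α s) (α t) (altProd α coroot k s t (α s)) := by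
  have h0 : α s = (1 : ℚ) • α s + (0 : ℚ) • α t := by module
  by_cases h4 : 4 ≤ A s t * A t s
  · left
    intro k
    conv => arg 3; rw [h0]
    exact isPosComb_altProd_of_four_le hpair hs ht hst hts h4 k zero_le_one le_rfl (by simp)
  · right
    have hcases : (A s t = 0 ∧ A t s = 0) ∨ (A s t = -1 ∧ A t s = -1) ∨
        (A s t = -1 ∧ A t s = -2) ∨ (A s t = -2 ∧ A t s = -1) ∨
        (A s t = -1 ∧ A t s = -3) ∨ (A s t = -3 ∧ A t s = -1) := by
      rcases hst.eq_or_lt with h | h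
      · exact .inl ⟨h, hz.1 h⟩
      · have h' : A t s < 0 := lt_of_le_of_ne hts fun e => h.ne (hz.2 e)
        have h1 : -4 < A s t := by nlinarith
        have h2 : -4 < A t s := by nlinarith
        generalize A s t = p at *
        generalize A t s = q at *
        interval_cases p <;> interval_cases q <;> simp_all
    have hx (x : V) : x = x - ((0 : ℚ) • α s + (0 : ℚ) • α t) := by module
    have hx' (x : V) : x = x - ((0 : ℚ) • α t + (0 : ℚ) • α s) := by module
    obtain ⟨m, hm⟩ : ∃ m : ℕ, (A s t = 0 ∧ A t s = 0 ∧ m = 1) ∨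
        (A s t = -1 ∧ A t s = -1 ∧ m = 2) ∨
        (A s t = -1 ∧ A t s = -2 ∧ m = 3) ∨ (A s t = -2 ∧ A t s = -1 ∧ m = 3) ∨
        (A s t = -1 ∧ A t s = -3 ∧ m = 5) ∨ (A s t = -3 ∧ A t s = -1 ∧ m = 5) := by
      rcases hcases with h | h | h | h | h | h
      exacts [⟨1, by simp [h]⟩, ⟨2, by simp [h]⟩, ⟨3, by simp [h]⟩, ⟨3, by simp [h]⟩,
        ⟨5, by simp [h]⟩, ⟨5, by simp [h]⟩]
    refine ⟨m, LinearMap.ext fun x => ?_, fun k hk => ?_⟩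
    · conv_lhs => rw [hx x]
      conv_rhs => rw [hx' x]
      rcases hm with ⟨h1, h2, rfl⟩ | ⟨h1, h2, rfl⟩ | ⟨h1, h2, rfl⟩ | ⟨h1, h2, rfl⟩ |
        ⟨h1, h2, rfl⟩ | ⟨h1, h2, rfl⟩ <;>
      · simp only [altProd_succ_sub hpair hs, altProd_succ_sub hpair ht, h1, h2]
        simp only [altProd, Module.End.one_apply]
        push_cast
        module
    · conv => arg 3; rw [h0]
      rcases hm with ⟨h1, h2, rfl⟩ | ⟨h1, h2, rfl⟩ | ⟨h1, h2, rfl⟩ | ⟨h1, h2, rfl⟩ |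
        ⟨h1, h2, rfl⟩ | ⟨h1, h2, rfl⟩ <;>
      · interval_cases k <;>
        · repeat' first
            | refine isPosComb_altProd_succ hpair ht ?_
            | refine isPosComb_altProd_succ hpair hs ?_
          apply isPosComb_altProd_zero <;> norm_num [h1, h2]

/-- The cone of nonnegative rational combinations of simple roots. -/
def rootCone (α : I → V) : PointedCone ℚ V :=
  Submodule.span _ (Set.range α)

theorem root_mem_rootCone (i : I) : α i ∈ rootCone α :=
  Submodule.subset_span ⟨i, rfl⟩

theorem smul_mem_rootCone {q : ℚ} (hq : 0 ≤ q) {x : V} (hx : x ∈ rootCone α) :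
    q • x ∈ rootCone α :=
  (rootCone α).smul_mem hq hx

theorem IsPosComb.map_mem_rootCone {x y z : V} (h : IsPosComb x y z) {v : Module.End ℚ V}
    (hx : v x ∈ rootCone α) (hy : v y ∈ rootCone α) : v z ∈ rootCone α := by
  obtain ⟨a, b, ha, hb, rfl⟩ := h
  rw [map_add, map_smul, map_smul]
  exact add_mem (smul_mem_rootCone ha hx) (smul_mem_rootCone hb hy)

theorem Qplus_subset_rootCone {x : V} (hx : x ∈ Qplus α) : x ∈ rootCone α := by
  obtain ⟨c, rfl⟩ := hx
  exact sum_mem fun j _ => smul_mem_rootCone (Nat.cast_nonneg _) (root_mem_rootCone j)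

/-- If `s` is not a right descent of `w`, then `w α_s` is positive. -/
theorem apply_root_mem_rootCone (hpair : ∀ i j, coroot i (α j) = (A i j : ℚ))
    (hoff : ∀ i j, i ≠ j → A i j ≤ 0) (hzero : ∀ i j, A i j = 0 ↔ A j i = 0)
    {w : Module.End ℚ V} (hw : w ∈ Wmon A α coroot) {s : I} (hs : A s s = 2)
    (hws : lenW A α coroot w ≤ lenW A α coroot (w * srefl α coroot s)) :
    w (α s) ∈ rootCone α := by
  induction hn : lenW A α coroot w using Nat.strong_induction_on generalizing w s with
  | _ n ih =>
    subst hn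
    by_cases hw1 : w = 1
    · subst hw1
      exact root_mem_rootCone s
    obtain ⟨t, ht, hwt⟩ := exists_right_descent hpair hw hw1
    have hne : s ≠ t := by
      rintro rfl
      exact hwt.not_ge hws
    obtain ⟨v, hv, k, hvk, hlen, hvs, hvt⟩ := exists_eq_mul_altProd hpair hs ht hw hws
    have hk : k ≠ 0 := by
      rintro rfl
      rw [altProd, mul_one] at hvk
      subst hvk
      exact hwt.not_ge hvt
    have hlt : lenW A α coroot v < lenW A α coroot w := by omega
    have hpos : IsPosComb (α s) (α t) (altProd α coroot k s t (α s)) := by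
      rcases rank_two hpair hs ht (hoff s t hne) (hoff t s hne.symm) (hzero s t) with
        h | ⟨m, hbraid, h⟩
      · exact h k
      · refine h k (not_lt.1 fun hmk => ?_)
        obtain ⟨j, rfl⟩ := Nat.exists_eq_add_of_le' hmk
        obtain ⟨x, hx, hxlen, hsplit⟩ :=
          altProd_add (α := α) (coroot := coroot) j (m + 1) hs ht
        have hwseq : w * srefl α coroot s = v * (x * altProd α coroot m s t) := by
          rw [hvk, hsplit, hbraid, altProd]
          simp only [mul_assoc, srefl_mul_self hpair hs, mul_one]
        obtain ⟨hmem, hmlen⟩ := altProd_mem_and_lenW_le (α := α) (coroot := coroot) m hs ht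
        have h1 := lenW_mul_le hv (mul_mem hx hmem)
        have h2 := lenW_mul_le hx hmem
        rw [hwseq] at hws
        omega
    rw [hvk, Module.End.mul_apply]
    exact hpos.map_mem_rootCone (ih _ hlt hv hs hvs rfl) (ih _ hlt hv ht hvt rfl)

/-- `w μ ≤ μ` whenever `μ` is dominant for the real coroots. -/
theorem sub_apply_mem_rootCone (hpair : ∀ i j, coroot i (α j) = (A i j : ℚ))
    (hoff : ∀ i j, i ≠ j → A i j ≤ 0) (hzero : ∀ i j, A i j = 0 ↔ A j i = 0)
    {μ : V} (hμ : ∀ j, A j j = 2 → 0 ≤ coroot j μ)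
    {w : Module.End ℚ V} (hw : w ∈ Wmon A α coroot) : μ - w μ ∈ rootCone α := by
  induction hn : lenW A α coroot w using Nat.strong_induction_on generalizing w with
  | _ n ih =>
    subst hn
    by_cases hw1 : w = 1
    · simp [hw1]
    obtain ⟨t, ht, hwt⟩ := exists_right_descent hpair hw hw1
    have hmem := mul_mem hw (srefl_mem_Wmon (α := α) (coroot := coroot) ht)
    have hback := mul_srefl_mul_srefl hpair ht w
    have hroot := apply_root_mem_rootCone hpair hoff hzero hmem ht (by rw [hback]; exact hwt.le)
    have hsum := add_mem (ih _ hwt hmem rfl) (smul_mem_rootCone (hμ t ht) hroot)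
    have hwμ : w μ = (w * srefl α coroot t) μ -
        coroot t μ • (w * srefl α coroot t) (α t) := by
      rw [← map_smul, ← map_sub, ← srefl_apply, ← Module.End.mul_apply, hback]
    rwa [hwμ, sub_sub_eq_add_sub, add_sub_right_comm]

theorem coroot_nonpos_of_mem_rootCone (hpair : ∀ i j, coroot i (α j) = (A i j : ℚ)) {i : I}
    (hrow : ∀ j, A i j ≤ 0) {x : V} (hx : x ∈ rootCone α) : coroot i x ≤ 0 := by
  induction hx using Submodule.span_induction with
  | mem x hx =>
    obtain ⟨j, rfl⟩ := hx
    rw [hpair]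
    exact_mod_cast hrow j
  | zero => simp
  | add x y _ _ hx hy =>
    rw [map_add]
    exact add_nonpos hx hy
  | smul q x _ hx =>
    have : coroot i (q • x) = (q : ℚ) * coroot i x := map_smul (coroot i) (q : ℚ) x
    rw [this]
    exact mul_nonpos_of_nonneg_of_nonpos q.2 hx

/-- All `W`-translates of elements of `Tλ` lie below `λ`. -/
theorem sub_apply_orbit_mem_rootCone (hpair : ∀ i j, coroot i (α j) = (A i j : ℚ))
    (hdiag : ∀ i, A i i = 2 ∨ A i i ≤ 0)
    (hoff : ∀ i j, i ≠ j → A i j ≤ 0) (hzero : ∀ i j, A i j = 0 ↔ A j i = 0)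
    {lam : V} (hlam : ∀ j, 0 ≤ coroot j lam) {τ : Module.End ℚ V}
    (hτ : τ ∈ Tmon α coroot) {w : Module.End ℚ V} (hw : w ∈ Wmon A α coroot) :
    lam - w (τ lam) ∈ rootCone α := by
  induction hτ using Submonoid.closure_induction_left generalizing w with
  | one => exact sub_apply_mem_rootCone hpair hoff hzero (fun j _ => hlam j) hw
  | mul_left r hr τ hτ ih =>
    obtain ⟨j, rfl⟩ := hr
    by_cases hj : A j j = 2
    · exact ih (mul_mem hw (srefl_mem_Wmon hj))
    have hrow : ∀ k, A j k ≤ 0 := fun k => by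
      rcases eq_or_ne j k with rfl | h
      exacts [(hdiag j).resolve_left hj, hoff j k h]
    have hc : 0 ≤ coroot j (τ lam) := by
      have h1 := coroot_nonpos_of_mem_rootCone hpair hrow (ih (one_mem _))
      have h2 := hlam j
      rw [map_sub, Module.End.one_apply] at h1
      linarith
    have hroot : w (α j) ∈ rootCone α := by
      have hdom : ∀ k, A k k = 2 → 0 ≤ coroot k (-α j) := fun k hk => by
        have hkj : A k j ≤ 0 := hoff k j fun e => hj (e ▸ hk)
        rw [map_neg, hpair, neg_nonneg]
        exact_mod_cast hkj
      have h := add_mem (sub_apply_mem_rootCone hpair hoff hzero hdom hw) (root_mem_rootCone j)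
      simpa using h
    have h := add_mem (ih hw) (smul_mem_rootCone hc hroot)
    rwa [Module.End.mul_apply, srefl_apply, map_sub, map_smul, sub_sub_eq_add_sub,
      add_sub_right_comm]

theorem coroot_orbit_nonneg (hpair : ∀ i j, coroot i (α j) = (A i j : ℚ))
    (hdiag : ∀ i, A i i = 2 ∨ A i i ≤ 0)
    (hoff : ∀ i j, i ≠ j → A i j ≤ 0) (hzero : ∀ i j, A i j = 0 ↔ A j i = 0)
    {lam : V} (hlam : ∀ j, 0 ≤ coroot j lam) {i : I} (hrow : ∀ j, A i j ≤ 0) {x : V}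
    (hx : x ∈ Torbit α coroot lam) : 0 ≤ coroot i x := by
  obtain ⟨τ, hτ, rfl⟩ := hx
  have h1 := coroot_nonpos_of_mem_rootCone hpair hrow
    (sub_apply_orbit_mem_rootCone hpair hdiag hoff hzero hlam hτ (one_mem _))
  have h2 := hlam i
  rw [map_sub, Module.End.one_apply] at h1
  linarith

theorem IsChain.coroot_le (hpair : ∀ i j, coroot i (α j) = (A i j : ℚ)) {i : I}
    (hrow : ∀ j, A i j ≤ 0) {lam μ ν : V} {s : ℕ} {c β : ℕ → V}
    {βv : ℕ → (V →ₗ[ℚ] ℚ)} (h : IsChain A α coroot lam μ ν s c β βv) :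
    coroot i ν ≤ coroot i μ := by
  obtain ⟨rfl, rfl, -, hstep⟩ := h
  have key : ∀ k ≤ s, coroot i (c k) ≤ coroot i (c 0) := by
    intro k
    induction k with
    | zero => exact fun _ => le_rfl
    | succ k ih =>
      intro hk
      refine le_trans ?_ (ih (by omega))
      obtain ⟨-, hβ, hpos, heq⟩ := hstep k hk
      have h1 := coroot_nonpos_of_mem_rootCone hpair hrow (Qplus_subset_rootCone hβ)
      rw [heq, map_sub, map_smul, smul_eq_mul]
      nlinarith
  exact key s le_rfl

end WeylGroup

section PiecewiseLinear

/-- The piecewise linear function with breakpoints `a` and slopes `d`. -/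
def plFun (a d : ℕ → ℚ) (s : ℕ) (t : ℚ) : ℚ :=
  ∑ k ∈ Finset.range s, max (min t (a (k + 1)) - a k) 0 * d k

theorem hFun_glsPath {I V : Type*} [AddCommGroup V] [Module ℚ V]
    (coroot : I → (V →ₗ[ℚ] ℚ)) (i : I) (lamseq : ℕ → V) (a : ℕ → ℚ) (s : ℕ) (t : ℚ) :
    hFun coroot i (glsPath lamseq a s) t = plFun a (fun k => coroot i (lamseq (k + 1))) s t := by
  simp [hFun, glsPath, plFun, map_sum]

variable {a d : ℕ → ℚ} {s : ℕ}

theorem plFun_mono (hd : ∀ k < s, 0 ≤ d k) : Monotone (plFun a d s) := by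
  intro t t' h
  refine Finset.sum_le_sum fun k hk => mul_le_mul_of_nonneg_right ?_ (hd k (Finset.mem_range.1 hk))
  gcongr

theorem breakpoint_le (ha : ∀ k < s, a k < a (k + 1)) {j k : ℕ} (hjk : j ≤ k) (hk : k ≤ s) :
    a j ≤ a k := by
  induction k, hjk using Nat.le_induction with
  | base => exact le_rfl
  | succ k _ ih => exact (ih (by omega)).trans (ha k hk).le

theorem plFun_zero (ha : ∀ k < s, a k < a (k + 1)) (h0 : a 0 = 0) : plFun a d s 0 = 0 := by
  refine Finset.sum_eq_zero fun k hk => ?_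
  have hk := Finset.mem_range.1 hk
  have h1 := breakpoint_le ha (Nat.zero_le k) hk.le
  rw [max_eq_right, zero_mul]
  have := min_le_left 0 (a (k + 1))
  linarith

theorem plFun_eq_on_segment (ha : ∀ k < s, a k < a (k + 1)) {k : ℕ} (hk : k < s) {t : ℚ}
    (h1 : a k ≤ t) (h2 : t ≤ a (k + 1)) :
    plFun a d s t = plFun a d s (a k) + (t - a k) * d k := by
  rw [← sub_eq_iff_eq_add', plFun, plFun, ← Finset.sum_sub_distrib,
    Finset.sum_eq_single_of_mem k (Finset.mem_range.2 hk)]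
  · rw [min_eq_left h2, min_eq_left (ha k hk).le, sub_self, max_self, max_eq_left (by linarith)]
    ring
  · intro j hj hjk
    have hj := Finset.mem_range.1 hj
    rcases lt_or_gt_of_ne hjk with h | h
    · have h3 : a (j + 1) ≤ a k := breakpoint_le ha h hk.le
      rw [min_eq_right (h3.trans h1), min_eq_right h3, sub_self]
    · have h3 : a (k + 1) ≤ a j := breakpoint_le ha h hj.le
      have h4 := ha j hj
      have h5 := ha k hk
      rw [min_eq_left (by linarith), min_eq_left (by linarith), max_eq_right (by linarith),
        max_eq_right (by linarith), sub_self]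

/-- A value between `plFun a d s 0 = 0` and `plFun a d s 1` is attained at a smallest point. -/
theorem exists_first_plFun_eq (ha : ∀ k < s, a k < a (k + 1)) (h0 : a 0 = 0) (h1 : a s = 1)
    (hd : ∀ k < s, 0 ≤ d k) {c : ℚ} (hc : 0 < c) (hc1 : c ≤ plFun a d s 1) :
    ∃ t, 0 ≤ t ∧ t ≤ 1 ∧ plFun a d s t = c ∧ ∀ t', plFun a d s t' = c → t ≤ t' := by
  classical
  have hex : ∃ k, k ≤ s ∧ c ≤ plFun a d s (a k) := ⟨s, le_rfl, by rwa [h1]⟩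
  obtain ⟨k, ⟨hks, hkc⟩, hmin⟩ :
      ∃ k, (k ≤ s ∧ c ≤ plFun a d s (a k)) ∧ ∀ j < k, ¬(j ≤ s ∧ c ≤ plFun a d s (a j)) :=
    ⟨Nat.find hex, Nat.find_spec hex, fun j => Nat.find_min hex⟩
  obtain _ | k := k
  · rw [h0, plFun_zero ha h0] at hkc
    exact absurd hkc hc.not_ge
  have hk : k < s := hks
  have hlow : plFun a d s (a k) < c := by
    by_contra h
    exact hmin k k.lt_succ_self ⟨hk.le, not_lt.1 h⟩
  have hak := ha k hk
  have hseg := plFun_eq_on_segment (d := d) ha hk hak.le le_rfl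
  have hdk : 0 < d k := by
    refine lt_of_le_of_ne (hd k hk) fun h => ?_
    rw [hseg, ← h] at hkc
    linarith
  set t := a k + (c - plFun a d s (a k)) / d k with ht
  have htd : (t - a k) * d k = c - plFun a d s (a k) := by
    rw [ht, add_sub_cancel_left, div_mul_cancel₀ _ hdk.ne']
  have hakt : a k ≤ t := by
    have : 0 ≤ (c - plFun a d s (a k)) / d k := div_nonneg (by linarith) hdk.le
    linarith
  have hta : t ≤ a (k + 1) := by
    have : (t - a k) * d k ≤ (a (k + 1) - a k) * d k := by linarith
    linarith [le_of_mul_le_mul_right this hdk]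
  have hval : plFun a d s t = c := by
    rw [plFun_eq_on_segment ha hk hakt hta]
    linarith
  refine ⟨t, ?_, ?_, hval, fun t' ht' => ?_⟩
  · linarith [breakpoint_le ha (Nat.zero_le k) hk.le]
  · linarith [breakpoint_le ha hks le_rfl]
  · by_contra! hlt
    rcases le_total t' (a k) with h | h
    · linarith [plFun_mono (a := a) hd h]
    · rw [plFun_eq_on_segment ha hk h (hlt.le.trans hta)] at ht'
      nlinarith

end PiecewiseLinear

end GKM

open GKM in
/-- For a GLS path `π` of shape `λ` and `i` imaginary: `h_i^π` is increasing,
`m_i^π = 0`, and either `f_+^i(π) = 0` with `f_i π ≠ 0` and `h_i^π` strictly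
increasing near `0`, or `f_+^i(π) = 1` with `f_i π = 0` and `h_i^π ≡ 0`.
Moreover `e_i π = 0` iff `α_i^∨(π(1)) < 1 - a_{ii}`. -/
theorem stmt13 {I V : Type*} [Countable I] [AddCommGroup V] [Module ℚ V]
    (A : I → I → ℤ) (α : I → V) (coroot : I → (V →ₗ[ℚ] ℚ))
    (hind : LinearIndependent ℚ α)
    (hpair : ∀ i j, coroot i (α j) = (A i j : ℚ))
    (hdiag : ∀ i, A i i = 2 ∨ A i i ≤ 0)
    (hoff : ∀ i j, i ≠ j → A i j ≤ 0)
    (hzero : ∀ i j, A i j = 0 ↔ A j i = 0)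
    (lam : V) (hlam : lam ∈ Pplus coroot)
    (s : ℕ) (lamseq : ℕ → V) (a : ℕ → ℚ)
    (hgls : IsGLS A α coroot lam s lamseq a)
    (i : I) (hi : A i i ≠ 2) :
    (∀ t t' : ℚ, 0 ≤ t → t ≤ t' → t' ≤ 1 →
      hFun coroot i (glsPath lamseq a s) t ≤ hFun coroot i (glsPath lamseq a s) t') ∧
    mOf coroot i (glsPath lamseq a s) = 0 ∧
    ((IsFPlus coroot i (glsPath lamseq a s) 0 ∧
        (∃ ε : ℚ, 0 < ε ∧ ∀ t t' : ℚ, 0 ≤ t → t < t' → t' ≤ ε →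
          hFun coroot i (glsPath lamseq a s) t <
            hFun coroot i (glsPath lamseq a s) t')) ∨
     (IsFPlus coroot i (glsPath lamseq a s) 1 ∧
        ∀ t : ℚ, 0 ≤ t → t ≤ 1 → hFun coroot i (glsPath lamseq a s) t = 0)) ∧
    ((¬ ∃ π' : ℚ → V, ERelIm A α coroot i (glsPath lamseq a s) π') ↔
      coroot i (glsPath lamseq a s 1) < 1 - (A i i : ℚ)) := by
  obtain ⟨hs, ha0, has, ha, horb, hchain, -⟩ := hgls
  have hii : (A i i : ℚ) ≤ 0 := by exact_mod_cast (hdiag i).resolve_left hi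
  have hrow : ∀ j, A i j ≤ 0 := fun j => by
    rcases eq_or_ne i j with rfl | h
    exacts [(hdiag i).resolve_left hi, hoff i j h]
  set π := glsPath lamseq a s with hπ
  set d : ℕ → ℚ := fun k => coroot i (lamseq (k + 1)) with hd_def
  have hd : ∀ k < s, 0 ≤ d k := fun k hk =>
    coroot_orbit_nonneg hpair hdiag hoff hzero hlam.2 hrow (horb (k + 1) (by omega) hk)
  have hd0 : ∀ k < s, d k ≤ d 0 := by
    intro k
    induction k with
    | zero => exact fun _ => le_rfl
    | succ k ih =>
      intro hk
      obtain ⟨_, _, _, _, _, -, hc, -⟩ := hchain (k + 1) (by omega) hk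
      exact (hc.coroot_le hpair hrow).trans (ih (by omega))
  have hfun : ∀ t, hFun coroot i π t = plFun a d s t := hFun_glsPath coroot i lamseq a s
  have hmono : Monotone (plFun a d s) := plFun_mono hd
  have hzero' : plFun a d s 0 = 0 := plFun_zero ha ha0
  have hm : mOf coroot i π = 0 := by
    refine IsLeast.csInf_eq ⟨⟨0, le_rfl, zero_le_one, by simp [hfun, hzero']⟩, ?_⟩
    rintro n ⟨t, ht0, -, htn⟩
    have := hmono ht0
    rw [hzero', ← hfun, htn] at this
    exact_mod_cast this
  have ha1 : 0 < a 1 := ha0 ▸ ha 0 hs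
  have hpos : 0 < d 0 → IsFPlus coroot i π 0 ∧
      ∃ ε : ℚ, 0 < ε ∧ ∀ t t' : ℚ, 0 ≤ t → t < t' → t' ≤ ε →
        hFun coroot i π t < hFun coroot i π t' := by
    intro h
    have hlin : ∀ t, 0 ≤ t → t ≤ a 1 → plFun a d s t = t * d 0 := fun t h1 h2 => by
      have := plFun_eq_on_segment (d := d) ha (k := 0) hs (by rwa [ha0]) h2
      rwa [ha0, hzero', zero_add, sub_zero] at this
    refine ⟨⟨le_rfl, zero_le_one, by simp [hfun, hzero', hm], fun t ht0 _ ht => ?_⟩,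
      a 1, ha1, fun t t' h1 h2 h3 => ?_⟩
    · by_contra! hlt
      have h1 := hmono (min_le_left t (a 1))
      have h2 := lt_min hlt ha1
      rw [hlin _ h2.le (min_le_right _ _), ← hfun, ht, hm, Int.cast_zero] at h1
      exact (mul_pos h2 h).not_ge h1
    · rw [hfun, hfun, hlin t h1 (h2.le.trans h3), hlin t' (h1.trans h2.le) h3]
      exact mul_lt_mul_of_pos_right h2 h
  have hzero_fun : d 0 ≤ 0 → ∀ t, plFun a d s t = 0 := fun h t =>
    Finset.sum_eq_zero fun k hk => by
      have hk := Finset.mem_range.1 hk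
      rw [le_antisymm ((hd0 k hk).trans h) (hd k hk), mul_zero]
  refine ⟨fun t t' _ h _ => by simpa only [hfun] using hmono h, hm, ?_, ?_⟩
  · rcases lt_or_ge 0 (d 0) with h | h
    · exact .inl (hpos h)
    · refine .inr ⟨⟨zero_le_one, le_rfl, ?_, fun t _ ht _ => ht⟩, fun t _ _ => ?_⟩
      · rw [hfun, hzero_fun h, hm, Int.cast_zero]
      · rw [hfun, hzero_fun h]
  · have h1eq : coroot i (π 1) = plFun a d s 1 := hfun 1
    rw [h1eq]
    constructor
    · contrapose!
      intro hle
      obtain ⟨tp, htp0, htp1, htp, hfirst⟩ :=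
        exists_first_plFun_eq ha ha0 has hd (by linarith) hle
      have hd0pos : 0 < d 0 := by
        by_contra! h
        rw [hzero_fun h] at hle
        linarith
      refine ⟨_, 0, tp, (hpos hd0pos).1, zero_lt_one, ⟨htp0, htp1, ?_, ?_⟩, ?_,
        fun _ _ _ => rfl⟩
      · rw [hfun, htp, hm, Int.cast_zero, zero_add]
      · intro t _ _ ht
        rw [hfun, hm, Int.cast_zero, zero_add] at ht
        exact hfirst t ht
      · intro t ht _
        have := hmono ht
        rw [hfun, hm, Int.cast_zero]
        linarith
    · rintro hlt ⟨_, tm, tp, -, -, ⟨-, htp1, htp, -⟩, -, -⟩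
      have := hmono htp1
      rw [hfun, hm, Int.cast_zero] at htp
      linarith
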